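/- arXiv:1805.11550 — 5 statements merged into one kernel-verified Lean document; each statement's English description precedes it below -/
import Mathlib

section
/- Let α be a real-valued function defined on pairs (p,q) with 0 ≤ p ≤ q ≤ 1 (thought of as a function on the nonempty closed subintervals [p,q] of [0,1]), taking values in [0,1], and satisfying: (i) α(r,r) = r for all r ∈ [0,1]; (ii) α(t·p + (1−t)·p', t·q + (1−t)·q') = t·α(p,q) + (1−t)·α(p',q') for all t ∈ [0,1] and all pairs (p,q), (p',q') with 0 ≤ p ≤ q ≤ 1 and 0 ≤ p' ≤ q' ≤ 1; and (iii) α(0, α(0,1)) = α(0,1). Then either α(p,q) = p for all 0 ≤ p ≤ q ≤ 1, or α(p,q) = q for all 0 ≤ p ≤ q ≤ 1. (That is, the only convex-powerset algebra structures on [0,1] are min and max.) -/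
/-- An affine function on the nonempty closed subintervals of `[0,1]` that fixes the points is
determined by its value on `[0,1]`. -/
theorem eq_add_sub_mul_of_affine_on_intervals (α : ℝ → ℝ → ℝ)
    (hunit : ∀ r ∈ Set.Icc (0 : ℝ) 1, α r r = r)
    (haff : ∀ t ∈ Set.Icc (0 : ℝ) 1, ∀ p q p' q' : ℝ,
      0 ≤ p → p ≤ q → q ≤ 1 → 0 ≤ p' → p' ≤ q' → q' ≤ 1 →
      α (t * p + (1 - t) * p') (t * q + (1 - t) * q')
        = t * α p q + (1 - t) * α p' q')
    {p q : ℝ} (hp : 0 ≤ p) (hpq : p ≤ q) (hq : q ≤ 1) :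
    α p q = p + (q - p) * α 0 1 := by
  have h0 : α 0 0 = 0 := hunit 0 (by simp)
  have h1 : α 1 1 = 1 := hunit 1 (by simp)
  rcases (hp.trans hpq).eq_or_lt with rfl | hq0
  · obtain rfl : p = 0 := le_antisymm hpq hp
    simp [h0]
  have hs0 : 0 ≤ p / q := by positivity
  have hs1 : p / q ≤ 1 := (div_le_one hq0).2 hpq
  have hs : α (p / q) 1 = p / q + (1 - p / q) * α 0 1 := by
    have h := haff (p / q) ⟨hs0, hs1⟩ 1 1 0 1 zero_le_one le_rfl le_rfl le_rfl zero_le_one le_rfl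
    simpa [h1] using h
  have h := haff q ⟨hq0.le, hq⟩ (p / q) 1 0 0 hs0 hs1 le_rfl le_rfl le_rfl zero_le_one
  have hqp : q * (p / q) = p := mul_div_cancel₀ p hq0.ne'
  simp only [hqp, mul_zero, mul_one, add_zero, h0, hs] at h
  rw [h]
  linear_combination (1 - α 0 1) * hqp

/-- The only convex-powerset algebra structures on `[0,1]` are `min` and `max`:
if `α`, viewed as a function on nonempty closed subintervals `[p,q] ⊆ [0,1]`, takes values
in `[0,1]`, satisfies the unit law `α(r,r) = r`, is affine, and satisfies the multiplication
law instance `α(0, α(0,1)) = α(0,1)`, then `α` is either `(p,q) ↦ p` or `(p,q) ↦ q`. -/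
theorem stmt2 (α : ℝ → ℝ → ℝ)
    (hrange : ∀ p q : ℝ, 0 ≤ p → p ≤ q → q ≤ 1 → α p q ∈ Set.Icc (0 : ℝ) 1)
    (hunit : ∀ r ∈ Set.Icc (0 : ℝ) 1, α r r = r)
    (haff : ∀ t ∈ Set.Icc (0 : ℝ) 1, ∀ p q p' q' : ℝ,
      0 ≤ p → p ≤ q → q ≤ 1 → 0 ≤ p' → p' ≤ q' → q' ≤ 1 →
      α (t * p + (1 - t) * p') (t * q + (1 - t) * q')
        = t * α p q + (1 - t) * α p' q')
    (hmul : α 0 (α 0 1) = α 0 1) :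
    (∀ p q : ℝ, 0 ≤ p → p ≤ q → q ≤ 1 → α p q = p) ∨
    (∀ p q : ℝ, 0 ≤ p → p ≤ q → q ≤ 1 → α p q = q) := by
  have key {p q : ℝ} := eq_add_sub_mul_of_affine_on_intervals α hunit haff (p := p) (q := q)
  obtain ⟨hc0, hc1⟩ := hrange 0 1 le_rfl zero_le_one le_rfl
  have hc : α 0 1 * (α 0 1 - 1) = 0 := by
    linear_combination hmul - key le_rfl hc0 hc1
  rcases mul_eq_zero.1 hc with h | h
  · left
    intro p q hp hpq hq
    rw [key hp hpq hq, h]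
    ring
  · right
    intro p q hp hpq hq
    rw [key hp hpq hq, sub_eq_zero.1 h]
    ring
end

section
/- The complex number z = 3/5 + (4/5)·i is not a root of unity: for every integer k ≥ 1, (3/5 + (4/5)·i)^k ≠ 1. -/
/-- Every positive power of `3 + 4i` is congruent to `3 + 4i` modulo `5` in the Gaussian integers. -/
theorem exists_three_add_four_mul_I_pow_succ_eq (n : ℕ) :
    ∃ a b : ℤ, (3 + 4 * Complex.I) ^ (n + 1) = a + b * Complex.I ∧ a % 5 = 3 ∧ b % 5 = 4 := by
  induction n with
  | zero => exact ⟨3, 4, by simp, by norm_num, by norm_num⟩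
  | succ n ih =>
    obtain ⟨a, b, h, ha, hb⟩ := ih
    refine ⟨3 * a - 4 * b, 4 * a + 3 * b, ?_, by omega, by omega⟩
    rw [pow_succ, h]
    push_cast
    linear_combination 4 * (b : ℂ) * Complex.I_sq

/-- The complex number `3/5 + (4/5)i` is not a root of unity. -/
theorem stmt9 : ∀ k : ℕ, 1 ≤ k → (3 / 5 + (4 / 5) * Complex.I) ^ k ≠ 1 := by
  intro k hk h
  obtain ⟨n, rfl⟩ := Nat.exists_eq_add_of_le' hk
  obtain ⟨a, b, hab, -, hb⟩ := exists_three_add_four_mul_I_pow_succ_eq n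
  have hpow : (a + b * Complex.I : ℂ) = ((5 ^ (n + 1) : ℝ) : ℂ) := by
    rw [← hab, show (3 + 4 * Complex.I : ℂ) = 5 * (3 / 5 + (4 / 5) * Complex.I) by ring,
      mul_pow, h]
    push_cast
    ring
  have him := congrArg Complex.im hpow
  rw [Complex.ofReal_im] at him
  have hb0 : b = 0 := by simpa using him
  omega
end

section
/- For every n ∈ ℕ, the real part of (3/5 + (4/5)·i)^n is nonzero: Re((3/5 + (4/5)·i)^n) ≠ 0. -/
theorem three_add_four_I_pow_succ (n : ℕ) :
    ∃ a b : ℤ, (3 + 4 * Complex.I) ^ (n + 1) =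
      ((5 * a + 3 : ℤ) : ℂ) + ((5 * b + 4 : ℤ) : ℂ) * Complex.I := by
  induction n with
  | zero => exact ⟨0, 0, by simp⟩
  | succ n ih =>
    obtain ⟨a, b, h⟩ := ih
    refine ⟨3 * a - 4 * b - 2, 4 * a + 3 * b + 4, ?_⟩
    rw [pow_succ, h]
    push_cast
    linear_combination (20 * (b : ℂ) + 16) * Complex.I_sq

theorem three_add_four_I_pow_re_ne_zero (n : ℕ) : ((3 + 4 * Complex.I) ^ n).re ≠ 0 := by
  cases n with
  | zero => simp
  | succ n =>
    obtain ⟨a, b, h⟩ := three_add_four_I_pow_succ n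
    have hre : ((3 + 4 * Complex.I) ^ (n + 1)).re = ((5 * a + 3 : ℤ) : ℝ) := by
      simp [h]
    rw [hre, Int.cast_ne_zero]
    omega

/-- The real part of `(3/5 + (4/5)i)^n` is nonzero for every `n`. -/
theorem stmt10 : ∀ n : ℕ, ((3 / 5 + (4 / 5) * Complex.I) ^ n).re ≠ 0 := by
  intro n h
  apply three_add_four_I_pow_re_ne_zero n
  have hscale : (3 + 4 * Complex.I) ^ n =
      ((5 ^ n : ℝ) : ℂ) * (3 / 5 + (4 / 5) * Complex.I) ^ n := by
    push_cast
    rw [← mul_pow]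
    ring
  rw [hscale, Complex.re_ofReal_mul, h, mul_zero]
end

section
/- Let X = (S_X, x0, γ_X, (δ_a)_{a∈A}) be a DPA over a finite nonempty alphabet A with language L_X, and let κ ∈ [0,1]. Define the NPA Y over A with state set S_X ⊔ {q0, q1}, initial state q0, output function equal to κ on q0 and q1 and to γ_X on S_X, and transitions, for each a ∈ A: τ_a(q0) = conv{ δ_{q1}, δ_{x0} }, τ_a(q1) = { δ_{q1} }, and τ_a(s) = { δ_a(s) } for s ∈ S_X (where δ_s denotes the Dirac distribution and conv the convex hull). Let Z be the one-state NPA with output κ and τ_a = Dirac self-loop for each a ∈ A. Then: (1) under min semantics, L^min_Y(u) = L^min_Z(u) for all u ∈ A* if and only if L_X(v) ≥ κ for all v ∈ A*; and (2) under max semantics, L^max_Y(u) = L^max_Z(u) for all u ∈ A* if and only if L_X(v) ≤ κ for all v ∈ A*. -/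
/-- The Dirac distribution at a state. -/
def dirac {S : Type*} [DecidableEq S] (s0 : S) : S → ℝ :=
  fun s => if s = s0 then 1 else 0

/-- A nondeterministic probabilistic automaton (data part). -/
structure NPA (A S : Type*) where
  init : S
  out : S → ℝ
  tr : A → S → Set (S → ℝ)

/-- One step of the determinized automaton on a set of distributions. -/
def NPA.step {A S : Type*} [Fintype S] (M : NPA A S) (a : A) (X : Set (S → ℝ)) :
    Set (S → ℝ) :=
  { d' | ∃ d ∈ X, ∃ f : S → S → ℝ, (∀ s, f s ∈ M.tr a s) ∧
      d' = fun s' => ∑ s, d s * f s s' }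

/-- The set of distributions reached after reading the word `u`. -/
def NPA.reach {A S : Type*} [Fintype S] [DecidableEq S] (M : NPA A S) (u : List A) :
    Set (S → ℝ) :=
  u.foldl (fun X a => M.step a X) {dirac M.init}

/-- The min-semantics language of an NPA. -/
noncomputable def NPA.Lmin {A S : Type*} [Fintype S] [DecidableEq S]
    (M : NPA A S) (u : List A) : ℝ :=
  sInf ((fun d => ∑ s, d s * M.out s) '' M.reach u)

/-- The max-semantics language of an NPA. -/
noncomputable def NPA.Lmax {A S : Type*} [Fintype S] [DecidableEq S]
    (M : NPA A S) (u : List A) : ℝ :=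
  sSup ((fun d => ∑ s, d s * M.out s) '' M.reach u)

/-- The state distribution of a DPA with initial state `x0` and transitions `δ` after
reading the word `u`. -/
def dpaDist {A S : Type*} [Fintype S] [DecidableEq S]
    (x0 : S) (δ : A → S → S → ℝ) (u : List A) : S → ℝ :=
  u.foldl (fun d a => fun s' => ∑ s, d s * δ a s s') (dirac x0)

/-- The language of a DPA `(S, x0, γ, δ)`. -/
def dpaLang {A S : Type*} [Fintype S] [DecidableEq S]
    (x0 : S) (γ : S → ℝ) (δ : A → S → S → ℝ) (u : List A) : ℝ :=
  ∑ s, dpaDist x0 δ u s * γ s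

/-- The NPA `Y` built from the DPA `X = (S, x0, γ, δ)` and the threshold `κ`:
its states are `S ⊔ {q0, q1}` (with `q0 = Sum.inr false` and `q1 = Sum.inr true`),
the initial state is `q0`, the output is `κ` on `q0, q1` and `γ` on `S`, and on each
letter `q0` moves into `conv {δ_{q1}, δ_{x0}}`, `q1` loops, and states of `S` follow
the transitions of `X`. -/
noncomputable def Ynpa {A S : Type*} [DecidableEq S]
    (x0 : S) (γ : S → ℝ) (δ : A → S → S → ℝ) (κ : ℝ) : NPA A (S ⊕ Bool) where
  init := Sum.inr false
  out := fun s => match s with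
    | Sum.inl s => γ s
    | Sum.inr _ => κ
  tr := fun a s => match s with
    | Sum.inr false =>
        convexHull ℝ ({dirac (Sum.inr true), dirac (Sum.inl x0)} : Set (S ⊕ Bool → ℝ))
    | Sum.inr true => {dirac (Sum.inr true)}
    | Sum.inl s => {fun s' => match s' with
        | Sum.inl t => δ a s t
        | Sum.inr _ => 0}

/-- The one-state NPA `Z` with output `κ` and a Dirac self-loop on every letter. -/
def Znpa (A : Type*) (κ : ℝ) : NPA A Unit where
  init := ()
  out := fun _ => κ
  tr := fun _ _ => {dirac ()}

theorem dirac_mem_stdSimplex {S : Type*} [Fintype S] [DecidableEq S] (s : S) :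
    dirac s ∈ stdSimplex ℝ S := by
  refine ⟨fun t => ?_, ?_⟩
  · unfold dirac
    split_ifs <;> norm_num
  · simp [dirac]

theorem sum_dirac_mul {S : Type*} [Fintype S] [DecidableEq S] (s : S) (g : S → ℝ) :
    ∑ t, dirac s t * g t = g s := by
  simp [dirac]

theorem NPA.reach_append_singleton {A S : Type*} [Fintype S] [DecidableEq S] (M : NPA A S)
    (u : List A) (a : A) : M.reach (u ++ [a]) = M.step a (M.reach u) := by
  simp [NPA.reach, List.foldl_append]

theorem NPA.reach_subset_stdSimplex {A S : Type*} [Fintype S] [DecidableEq S] (M : NPA A S)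
    (hM : ∀ a s, M.tr a s ⊆ stdSimplex ℝ S) (u : List A) : M.reach u ⊆ stdSimplex ℝ S := by
  induction u using List.reverseRecOn with
  | nil =>
    rintro d rfl
    exact dirac_mem_stdSimplex _
  | append_singleton u a ih =>
    rw [NPA.reach_append_singleton]
    rintro _ ⟨d, hd, f, hf, rfl⟩
    have hd := ih hd
    refine ⟨fun t => Finset.sum_nonneg fun s _ =>
      mul_nonneg (hd.1 s) ((hM a s (hf s)).1 t), ?_⟩
    rw [Finset.sum_comm]
    simp_rw [← Finset.mul_sum, (hM a _ (hf _)).2, mul_one]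
    exact hd.2

theorem dpaDist_append_singleton {A S : Type*} [Fintype S] [DecidableEq S]
    (x : S) (δ : A → S → S → ℝ) (u : List A) (a : A) :
    dpaDist x δ (u ++ [a]) = fun t => ∑ s, dpaDist x δ u s * δ a s t := by
  simp [dpaDist, List.foldl_append]

theorem dpaDist_cons {A S : Type*} [Fintype S] [DecidableEq S]
    (x : S) (δ : A → S → S → ℝ) (a : A) (u : List A) :
    dpaDist x δ (a :: u) = fun t => ∑ s, δ a x s * dpaDist s δ u t := by
  induction u using List.reverseRecOn with
  | nil =>
    funext t
    simp [dpaDist, dirac]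
  | append_singleton u b ih =>
    rw [← List.cons_append, dpaDist_append_singleton, ih]
    funext t
    simp_rw [dpaDist_append_singleton, Finset.sum_mul, Finset.mul_sum, mul_assoc]
    exact Finset.sum_comm

theorem dpaLang_nil {A S : Type*} [Fintype S] [DecidableEq S]
    (x : S) (γ : S → ℝ) (δ : A → S → S → ℝ) : dpaLang x γ δ [] = γ x :=
  sum_dirac_mul x γ

theorem dpaLang_cons {A S : Type*} [Fintype S] [DecidableEq S]
    (x : S) (γ : S → ℝ) (δ : A → S → S → ℝ) (a : A) (u : List A) :
    dpaLang x γ δ (a :: u) = ∑ s, δ a x s * dpaLang s γ δ u := by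
  simp_rw [dpaLang, dpaDist_cons, Finset.sum_mul, Finset.mul_sum, mul_assoc]
  exact Finset.sum_comm

theorem Znpa_reach {A : Type*} (κ : ℝ) (u : List A) : (Znpa A κ).reach u = {dirac ()} := by
  induction u using List.reverseRecOn with
  | nil => rfl
  | append_singleton u a ih =>
    rw [NPA.reach_append_singleton, ih]
    ext d
    simp only [NPA.step, Znpa, Set.mem_singleton_iff, exists_eq_left, Set.mem_ofPred_eq]
    constructor
    · rintro ⟨f, hf, rfl⟩
      funext s
      simp [hf, dirac]
    · rintro rfl
      exact ⟨fun _ => dirac (), fun _ => rfl, by funext s; simp [dirac]⟩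

theorem Znpa_Lmin {A : Type*} (κ : ℝ) (u : List A) : (Znpa A κ).Lmin u = κ := by
  rw [NPA.Lmin, Znpa_reach]
  simp [dirac, Znpa]

theorem Znpa_Lmax {A : Type*} (κ : ℝ) (u : List A) : (Znpa A κ).Lmax u = κ := by
  rw [NPA.Lmax, Znpa_reach]
  simp [dirac, Znpa]

theorem Ynpa_exists_step {A S : Type*} [DecidableEq S] (x0 : S) (γ : S → ℝ)
    (δ : A → S → S → ℝ) (κ : ℝ) (a : A) {e : S ⊕ Bool → ℝ} (he : e = dirac (Sum.inr true) ∨ e = dirac (Sum.inl x0)) :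
    ∃ f : S ⊕ Bool → S ⊕ Bool → ℝ, (∀ s, f s ∈ (Ynpa x0 γ δ κ).tr a s) ∧
      f (Sum.inr false) = e ∧ f (Sum.inr true) = dirac (Sum.inr true) ∧
      ∀ s, f (Sum.inl s) = Sum.elim (δ a s) 0 := by
  refine ⟨Sum.elim (fun s => Sum.elim (δ a s) 0) fun b => if b then dirac (Sum.inr true) else e,
    ?_, by simp, by simp, fun s => rfl⟩
  rintro (s | _ | _)
  · refine Set.mem_singleton_iff.2 ?_
    funext t
    cases t <;> rfl
  · exact subset_convexHull ℝ _ (by simpa using he)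
  · exact Set.mem_singleton_iff.2 (by simp)

section Ynpa

variable {A S : Type*} [Fintype S] [DecidableEq S] {x0 : S} {γ : S → ℝ} {δ : A → S → S → ℝ}
  {κ : ℝ}

theorem Ynpa_tr_subset_stdSimplex
    (hδ : ∀ a s, (∀ s', 0 ≤ δ a s s') ∧ ∑ s', δ a s s' = 1) (a : A) (s : S ⊕ Bool) :
    (Ynpa x0 γ δ κ).tr a s ⊆ stdSimplex ℝ (S ⊕ Bool) := by
  rcases s with s | _ | _
  · rintro _ rfl
    refine ⟨?_, ?_⟩
    · rintro (t | b)
      · exact (hδ a s).1 t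
      · exact le_rfl
    · simpa [Fintype.sum_sum_type] using (hδ a s).2
  · refine convexHull_min ?_ (convex_stdSimplex ℝ _)
    rintro _ (rfl | rfl) <;> exact dirac_mem_stdSimplex _
  · rintro _ rfl
    exact dirac_mem_stdSimplex _

/-- The expected output of a distribution on the states of `Y` differs from `κ` only through
the mass on the states of `X`. -/
theorem Ynpa_value_sub {d : S ⊕ Bool → ℝ} (hd : d ∈ stdSimplex ℝ (S ⊕ Bool)) :
    ∑ s, d s * (Ynpa x0 γ δ κ).out s - κ = ∑ s, d (Sum.inl s) * (γ s - κ) := by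
  have h := hd.2
  simp only [Fintype.sum_sum_type, Fintype.sum_bool] at h
  simp only [Fintype.sum_sum_type, Fintype.sum_bool, Ynpa, mul_sub, Finset.sum_sub_distrib,
    ← Finset.sum_mul]
  linear_combination κ * h

theorem Ynpa_value_mem_Icc (hγ : ∀ s, γ s ∈ Set.Icc (0 : ℝ) 1) (hκ : κ ∈ Set.Icc (0 : ℝ) 1)
    {d : S ⊕ Bool → ℝ} (hd : d ∈ stdSimplex ℝ (S ⊕ Bool)) :
    ∑ s, d s * (Ynpa x0 γ δ κ).out s ∈ Set.Icc (0 : ℝ) 1 := by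
  have hout : ∀ s, (Ynpa x0 γ δ κ).out s ∈ Set.Icc (0 : ℝ) 1 := by
    rintro (s | b)
    exacts [hγ s, hκ]
  refine ⟨Finset.sum_nonneg fun s _ => mul_nonneg (hd.1 s) (hout s).1, ?_⟩
  rw [← hd.2]
  exact Finset.sum_le_sum fun s _ => mul_le_of_le_one_right (hd.1 s) (hout s).2

/-- If all `ε * (L_X v - κ)` are nonnegative, then so are the corresponding averages over the
mass that a reachable distribution of `Y` puts on the states of `X`. -/
theorem Ynpa_reach_nonneg (hδ : ∀ a s, (∀ s', 0 ≤ δ a s s') ∧ ∑ s', δ a s s' = 1)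
    {ε : ℝ} (h : ∀ v, 0 ≤ ε * (dpaLang x0 γ δ v - κ)) (u : List A) :
    ∀ d ∈ (Ynpa x0 γ δ κ).reach u, ∀ v,
      0 ≤ ε * ∑ s, d (Sum.inl s) * (dpaLang s γ δ v - κ) := by
  induction u using List.reverseRecOn with
  | nil =>
    rintro _ rfl v
    simp [Ynpa, dirac]
  | append_singleton u a ih =>
    rw [NPA.reach_append_singleton]
    rintro _ ⟨d, hd, f, hf, rfl⟩ v
    have hd0 : 0 ≤ d (Sum.inr false) :=
      ((Ynpa x0 γ δ κ).reach_subset_stdSimplex (Ynpa_tr_subset_stdSimplex hδ) u hd).1 _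
    have hl : ∀ s t, f (Sum.inl s) (Sum.inl t) = δ a s t := fun s t => by
      rw [show f (Sum.inl s) = _ from hf (Sum.inl s)]
    have h1 : ∀ t, f (Sum.inr true) (Sum.inl t) = 0 := fun t => by
      rw [show f (Sum.inr true) = _ from hf (Sum.inr true)]
      simp [dirac]
    obtain ⟨p, hp, h0⟩ : ∃ p : ℝ, 0 ≤ p ∧
        ∀ t, f (Sum.inr false) (Sum.inl t) = p * dirac x0 t := by
      have hmem : f (Sum.inr false) ∈ convexHull ℝ
          ({dirac (Sum.inr true), dirac (Sum.inl x0)} : Set (S ⊕ Bool → ℝ)) :=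
        hf (Sum.inr false)
      rw [convexHull_pair] at hmem
      obtain ⟨q, p, _, hp, _, he⟩ := hmem
      refine ⟨p, hp, fun t => ?_⟩
      rw [← he]
      simp [dirac]
    have key : ∑ t, (∑ s, d s * f s (Sum.inl t)) * (dpaLang t γ δ v - κ) =
        ∑ s, d (Sum.inl s) * (dpaLang s γ δ (a :: v) - κ) +
          d (Sum.inr false) * p * (dpaLang x0 γ δ v - κ) := by
      have hstep : ∀ s, dpaLang s γ δ (a :: v) - κ = ∑ t, δ a s t * (dpaLang t γ δ v - κ) := by
        intro s
        simp only [dpaLang_cons, mul_sub, Finset.sum_sub_distrib, ← Finset.sum_mul, (hδ a s).2,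
          one_mul]
      simp only [Fintype.sum_sum_type, Fintype.sum_bool, hl, h1, h0, hstep, mul_zero, zero_add,
        add_mul, Finset.sum_add_distrib]
      congr 1
      · simp_rw [Finset.sum_mul, Finset.mul_sum, mul_assoc]
        exact Finset.sum_comm
      · rw [← sum_dirac_mul x0 fun t => dpaLang t γ δ v - κ, Finset.mul_sum]
        exact Finset.sum_congr rfl fun t _ => by ring
    rw [key, mul_add]
    have := mul_nonneg (mul_nonneg hd0 hp) (h v)
    linarith [ih d hd (a :: v)]

theorem Ynpa_value_nonneg (hδ : ∀ a s, (∀ s', 0 ≤ δ a s s') ∧ ∑ s', δ a s s' = 1)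
    {ε : ℝ} (h : ∀ v, 0 ≤ ε * (dpaLang x0 γ δ v - κ)) {u : List A}
    {d : S ⊕ Bool → ℝ} (hd : d ∈ (Ynpa x0 γ δ κ).reach u) :
    0 ≤ ε * (∑ s, d s * (Ynpa x0 γ δ κ).out s - κ) := by
  rw [Ynpa_value_sub
    ((Ynpa x0 γ δ κ).reach_subset_stdSimplex (Ynpa_tr_subset_stdSimplex hδ) u hd)]
  simpa only [dpaLang_nil] using Ynpa_reach_nonneg hδ h u d hd []

theorem Ynpa_exists_dirac_inr_mem_reach (x0 : S) (γ : S → ℝ) (δ : A → S → S → ℝ) (κ : ℝ)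
    (u : List A) : ∃ b : Bool, dirac (Sum.inr b) ∈ (Ynpa x0 γ δ κ).reach u := by
  induction u using List.reverseRecOn with
  | nil => exact ⟨false, rfl⟩
  | append_singleton u a ih =>
    obtain ⟨b, hb⟩ := ih
    obtain ⟨f, hf, h0, h1, -⟩ := Ynpa_exists_step x0 γ δ κ a (Or.inl rfl)
    refine ⟨true, ?_⟩
    rw [NPA.reach_append_singleton]
    refine ⟨_, hb, f, hf, ?_⟩
    funext t
    rw [sum_dirac_mul _ fun s => f s t]
    cases b <;> simp [h0, h1]

theorem Ynpa_mem_image_reach (x0 : S) (γ : S → ℝ) (δ : A → S → S → ℝ) (κ : ℝ) (u : List A) :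
    κ ∈ (fun d => ∑ s, d s * (Ynpa x0 γ δ κ).out s) '' (Ynpa x0 γ δ κ).reach u := by
  obtain ⟨b, hb⟩ := Ynpa_exists_dirac_inr_mem_reach x0 γ δ κ u
  exact ⟨_, hb, sum_dirac_mul _ _⟩

theorem Ynpa_dpaDist_mem_reach (x0 : S) (γ : S → ℝ) (δ : A → S → S → ℝ) (κ : ℝ) (a : A)
    (v : List A) : Sum.elim (dpaDist x0 δ v) 0 ∈ (Ynpa x0 γ δ κ).reach (a :: v) := by
  induction v using List.reverseRecOn with
  | nil =>
    obtain ⟨f, hf, h0, -, -⟩ := Ynpa_exists_step x0 γ δ κ a (Or.inr rfl)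
    rw [← List.nil_append [a], NPA.reach_append_singleton]
    refine ⟨_, rfl, f, hf, ?_⟩
    funext t
    rw [sum_dirac_mul _ fun s => f s t, show (Ynpa x0 γ δ κ).init = Sum.inr false from rfl, h0]
    cases t <;> simp [dpaDist, dirac]
  | append_singleton v b ih =>
    obtain ⟨f, hf, -, -, hl⟩ := Ynpa_exists_step x0 γ δ κ b (Or.inr rfl)
    rw [← List.cons_append, NPA.reach_append_singleton]
    refine ⟨_, ih, f, hf, ?_⟩
    funext t
    cases t <;> simp [dpaDist_append_singleton, Fintype.sum_sum_type, hl]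

theorem Ynpa_dpaLang_mem_image_reach (x0 : S) (γ : S → ℝ) (δ : A → S → S → ℝ) (κ : ℝ) (a : A)
    (v : List A) : dpaLang x0 γ δ v ∈
      (fun d => ∑ s, d s * (Ynpa x0 γ δ κ).out s) '' (Ynpa x0 γ δ κ).reach (a :: v) := by
  refine ⟨_, Ynpa_dpaDist_mem_reach x0 γ δ κ a v, ?_⟩
  simp [Fintype.sum_sum_type, dpaLang, Ynpa]

theorem Ynpa_image_reach_subset_Icc (hγ : ∀ s, γ s ∈ Set.Icc (0 : ℝ) 1)
    (hδ : ∀ a s, (∀ s', 0 ≤ δ a s s') ∧ ∑ s', δ a s s' = 1) (hκ : κ ∈ Set.Icc (0 : ℝ) 1)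
    (u : List A) :
    (fun d => ∑ s, d s * (Ynpa x0 γ δ κ).out s) '' (Ynpa x0 γ δ κ).reach u ⊆
      Set.Icc (0 : ℝ) 1 := by
  rintro _ ⟨d, hd, rfl⟩
  exact Ynpa_value_mem_Icc hγ hκ
    ((Ynpa x0 γ δ κ).reach_subset_stdSimplex (Ynpa_tr_subset_stdSimplex hδ) u hd)

end Ynpa

/-- For a DPA `X` with language `L_X` and a threshold `κ ∈ [0,1]`: under min semantics,
`Y` and `Z` are language equivalent iff `L_X(v) ≥ κ` for all words `v`; under max
semantics, `Y` and `Z` are language equivalent iff `L_X(v) ≤ κ` for all words `v`. -/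
theorem stmt13 {A S : Type*} [Fintype A] [Nonempty A] [Fintype S] [DecidableEq S]
    (x0 : S) (γ : S → ℝ) (δ : A → S → S → ℝ)
    (hγ : ∀ s, γ s ∈ Set.Icc (0 : ℝ) 1)
    (hδ : ∀ a s, (∀ s', 0 ≤ δ a s s') ∧ ∑ s', δ a s s' = 1)
    (κ : ℝ) (hκ : κ ∈ Set.Icc (0 : ℝ) 1) :
    ((∀ u : List A, (Ynpa x0 γ δ κ).Lmin u = (Znpa A κ).Lmin u)
        ↔ ∀ v : List A, κ ≤ dpaLang x0 γ δ v) ∧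
    ((∀ u : List A, (Ynpa x0 γ δ κ).Lmax u = (Znpa A κ).Lmax u)
        ↔ ∀ v : List A, dpaLang x0 γ δ v ≤ κ) := by
  obtain ⟨a⟩ := ‹Nonempty A›
  simp_rw [Znpa_Lmin, Znpa_Lmax]
  refine ⟨⟨fun h v => ?_, fun h u => ?_⟩, ⟨fun h v => ?_, fun h u => ?_⟩⟩
  · rw [← h (a :: v)]
    exact csInf_le (bddBelow_Icc.mono (Ynpa_image_reach_subset_Icc hγ hδ hκ _))
      (Ynpa_dpaLang_mem_image_reach x0 γ δ κ a v)
  · refine IsLeast.csInf_eq ⟨Ynpa_mem_image_reach x0 γ δ κ u, ?_⟩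
    rintro _ ⟨d, hd, rfl⟩
    have := Ynpa_value_nonneg hδ (ε := 1) (fun v => by linarith [h v]) hd
    dsimp only
    linarith
  · rw [← h (a :: v)]
    exact le_csSup (bddAbove_Icc.mono (Ynpa_image_reach_subset_Icc hγ hδ hκ _))
      (Ynpa_dpaLang_mem_image_reach x0 γ δ κ a v)
  · refine IsGreatest.csSup_eq ⟨Ynpa_mem_image_reach x0 γ δ κ u, ?_⟩
    rintro _ ⟨d, hd, rfl⟩
    have := Ynpa_value_nonneg hδ (ε := -1) (fun v => by linarith [h v]) hd
    dsimp only
    linarith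
end

section
/- (Skolem–Mahler–Lech) If ⟨u_n⟩ is a real linear recurrence sequence, then its zero set { n ∈ ℕ : u_n = 0 } is the union of a finite set and finitely many arithmetic progressions, i.e., finitely many sets of the form { p + kn : n ∈ ℕ } with p ∈ ℕ and integer k ≥ 1. -/
open Polynomial in
lemma exists_eq_X_sub_C_mul_of_norm_coeff_le {p : ℕ} [Fact p.Prime] {ρ B : ℝ} (hρ : 0 ≤ ρ)
    (hρ1 : ρ ≤ 1) (hB : 0 ≤ B) {P : ℚ_[p][X]} (hP : ∀ i, ‖P.coeff i‖ ≤ B * ρ ^ i)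
    {t : ℚ_[p]} (ht : ‖t‖ ≤ 1) (h0 : P.IsRoot t) :
    ∃ Q : ℚ_[p][X], P = (X - C t) * Q ∧ ∀ i, ‖Q.coeff i‖ ≤ B * ρ * ρ ^ i := by
  refine ⟨P /ₘ (X - C t), (mul_divByMonic_eq_iff_isRoot.2 h0).symm, fun i ↦ ?_⟩
  rw [coeff_divByMonic_X_sub_C]
  refine IsUltrametricDist.norm_sum_le_of_forall_le_of_nonneg (by positivity) fun j hj ↦ ?_
  rw [norm_mul, norm_pow]
  calc ‖t‖ ^ (j - (i + 1)) * ‖P.coeff j‖ ≤ 1 * (B * ρ ^ j) :=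
        mul_le_mul (pow_le_one₀ (norm_nonneg _) ht) (hP j) (norm_nonneg _) zero_le_one
    _ ≤ B * ρ ^ (i + 1) := by
        rw [one_mul]
        exact mul_le_mul_of_nonneg_left
          (pow_le_pow_of_le_one hρ hρ1 (Finset.mem_Icc.1 hj).1) hB
    _ = B * ρ * ρ ^ i := by ring

open Polynomial in
lemma norm_eval_le_of_norm_coeff_le {p : ℕ} [Fact p.Prime] {B : ℝ} (hB : 0 ≤ B) {P : ℚ_[p][X]}
    (hP : ∀ i, ‖P.coeff i‖ ≤ B) {x : ℚ_[p]} (hx : ‖x‖ ≤ 1) : ‖P.eval x‖ ≤ B := by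
  rw [eval_eq_sum_range]
  refine IsUltrametricDist.norm_sum_le_of_forall_le_of_nonneg hB fun j _ ↦ ?_
  rw [norm_mul, norm_pow]
  exact (mul_le_mul (hP j) (pow_le_one₀ (norm_nonneg _) hx) (by positivity) hB).trans_eq (mul_one B)

/-- A polynomial with geometrically decaying coefficients and many roots in the unit ball is
small on the unit ball. -/
lemma norm_eval_le_pow_card_of_isRoot {p : ℕ} [Fact p.Prime] {ρ : ℝ} (hρ : 0 ≤ ρ) (hρ1 : ρ ≤ 1)
    (Z : Finset ℚ_[p]) (hZ : ∀ t ∈ Z, ‖t‖ ≤ 1) {B : ℝ} (hB : 0 ≤ B) {P : Polynomial ℚ_[p]}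
    (hP : ∀ i, ‖P.coeff i‖ ≤ B * ρ ^ i) (h0 : ∀ t ∈ Z, P.IsRoot t) {x : ℚ_[p]} (hx : ‖x‖ ≤ 1) :
    ‖P.eval x‖ ≤ B * ρ ^ Z.card := by
  classical
  induction Z using Finset.induction_on generalizing B P with
  | empty =>
    simpa using norm_eval_le_of_norm_coeff_le hB
      (fun i ↦ (hP i).trans (mul_le_of_le_one_right hB (pow_le_one₀ hρ hρ1))) hx
  | insert t s hts ih =>
    simp only [Finset.mem_insert, forall_eq_or_imp] at hZ h0
    obtain ⟨Q, rfl, hQ⟩ := exists_eq_X_sub_C_mul_of_norm_coeff_le hρ hρ1 hB hP hZ.1 h0.1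
    have hQ0 : ∀ r ∈ s, Q.IsRoot r := fun r hr ↦ by
      have h := h0.2 r hr
      rw [Polynomial.IsRoot, Polynomial.eval_mul, mul_eq_zero] at h
      refine h.resolve_left fun h' ↦ hts ?_
      have : r = t := by simpa [sub_eq_zero] using h'
      exact this ▸ hr
    have h1 : ‖x - t‖ ≤ 1 := by
      rw [sub_eq_add_neg]
      exact (IsUltrametricDist.norm_add_le_max _ _).trans (by simp [hx, hZ.1])
    rw [Polynomial.eval_mul, norm_mul, Finset.card_insert_of_notMem hts]
    calc _ ≤ 1 * (B * ρ * ρ ^ s.card) :=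
          mul_le_mul (by simpa using h1) (ih hZ.2 (by positivity) hQ hQ0)
            (norm_nonneg _) zero_le_one
      _ = B * ρ ^ (s.card + 1) := by ring

lemma norm_coeff_descPochhammer_le_one (p : ℕ) [Fact p.Prime] (j i : ℕ) :
    ‖(descPochhammer ℚ_[p] j).coeff i‖ ≤ 1 := by
  rw [← descPochhammer_map (Int.castRingHom ℚ_[p]) j, Polynomial.coeff_map]
  exact Padic.norm_int_le_one _

/-- A Newton series with geometrically decaying coefficients that has infinitely many zeros
vanishes identically. -/
lemma eq_zero_of_infinite_zeros {p : ℕ} [Fact p.Prime] {ρ : ℝ} (hρ : 0 ≤ ρ) (hρ1 : ρ < 1)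
    {e : ℕ → ℚ_[p]} (he : ∀ j, ‖e j‖ ≤ ρ ^ j) {f : ℕ → ℚ_[p]}
    (hf : ∀ n, f n = ∑ j ∈ Finset.range (n + 1), e j * (n.descFactorial j : ℚ_[p]))
    (hinf : {n | f n = 0}.Infinite) (x : ℕ) : f x = 0 := by
  classical
  have key : ∀ s : ℕ, ‖f x‖ ≤ ρ ^ s := by
    intro s
    obtain ⟨Z, hZ, hcard⟩ := hinf.exists_subset_card_eq s
    obtain ⟨M, hxM, hZM⟩ : ∃ M, x ≤ M ∧ ∀ t ∈ Z, t ≤ M :=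
      ⟨max x (Z.sup id), le_max_left _ _, fun t ht ↦
        (Finset.le_sup (f := id) ht).trans (le_max_right _ _)⟩
    set P : Polynomial ℚ_[p] :=
      ∑ j ∈ Finset.range (M + 1), Polynomial.C (e j) * descPochhammer ℚ_[p] j with hPdef
    have hPf : ∀ n ≤ M, P.eval (n : ℚ_[p]) = f n := by
      intro n hn
      rw [hPdef, Polynomial.eval_finsetSum, hf]
      symm
      refine Finset.sum_subset_zero_on_sdiff (by simpa using hn) (fun j hj ↦ ?_) fun j _ ↦ ?_
      · simp only [Finset.mem_sdiff, Finset.mem_range, not_lt] at hj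
        rw [Polynomial.eval_mul, descPochhammer_eval_eq_descFactorial,
          Nat.descFactorial_of_lt (by lia)]
        simp
      · rw [Polynomial.eval_mul, descPochhammer_eval_eq_descFactorial, Polynomial.eval_C]
    have hP : ∀ i, ‖P.coeff i‖ ≤ 1 * ρ ^ i := by
      intro i
      rw [hPdef, Polynomial.finsetSum_coeff, one_mul]
      refine IsUltrametricDist.norm_sum_le_of_forall_le_of_nonneg (by positivity) fun j _ ↦ ?_
      rw [Polynomial.coeff_C_mul, norm_mul]
      rcases lt_or_ge j i with h | h
      · rw [Polynomial.coeff_eq_zero_of_natDegree_lt]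
        · simpa using pow_nonneg hρ i
        · rwa [descPochhammer_natDegree]
      · calc _ ≤ ρ ^ j * 1 := mul_le_mul (he j) (norm_coeff_descPochhammer_le_one p j i)
              (norm_nonneg _) (by positivity)
          _ ≤ ρ ^ i := by simpa using pow_le_pow_of_le_one hρ hρ1.le h
    have hinj : Function.Injective (Nat.cast : ℕ → ℚ_[p]) := Nat.cast_injective
    have hnorm : ∀ n : ℕ, ‖(n : ℚ_[p])‖ ≤ 1 := fun n ↦ by
      simpa using Padic.norm_int_le_one (p := p) n
    have := norm_eval_le_pow_card_of_isRoot hρ hρ1.le (Z.map ⟨_, hinj⟩)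
      (by simpa using fun a _ ↦ hnorm a) zero_le_one hP
      (by
        simp only [Finset.mem_map, Function.Embedding.coeFn_mk, forall_exists_index, and_imp,
          forall_apply_eq_imp_iff₂]
        intro a ha
        rw [Polynomial.IsRoot, hPf a (hZM a ha)]
        exact hZ ha) (hnorm x)
    rwa [hPf x hxM, Finset.card_map, hcard, one_mul] at this
  have := ge_of_tendsto' (tendsto_pow_atTop_nhds_zero_of_lt_one hρ hρ1) key
  simpa using this

lemma norm_prime_pow_le_norm_factorial (p : ℕ) [hp : Fact p.Prime] (j : ℕ) :
    ‖(p : ℚ_[p]) ^ j‖ ≤ ‖(j.factorial : ℚ_[p])‖ := by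
  by_contra! h
  rw [Padic.norm_p_pow, ← neg_add_cancel_right (-(j : ℤ)) 1,
    ← Padic.norm_le_pow_iff_norm_lt_pow_add_one] at h
  have h1 : ‖((j.factorial : ℤ) : ℚ_[p])‖ ≤ (p : ℝ) ^ (-((j + 1 : ℕ) : ℤ)) := by
    rw [Int.cast_natCast]
    convert h using 2
    push_cast; ring
  rw [Padic.norm_int_le_pow_iff_dvd] at h1
  have h2 : p ^ (j + 1) ∣ j.factorial := by exact_mod_cast h1
  rw [padicValNat_dvd_iff_le (Nat.factorial_ne_zero j)] at h2
  have h3 := sub_one_mul_padicValNat_factorial (p := p) j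
  have h4 : 1 ≤ p - 1 := by have := hp.out.two_le; lia
  have := Nat.mul_le_mul_right (padicValNat p j.factorial) h4
  lia

/-- Some positive power of an invertible `p`-adic operator is congruent to `1` modulo `p ^ k`. -/
lemma exists_pow_eq_one_add_smul {p : ℕ} [Fact p.Prime] {M : Type*} [AddCommGroup M]
    [Module ℤ_[p] M] [Module.Finite ℤ_[p] M] [Module.Free ℤ_[p] M] {T : Module.End ℤ_[p] M}
    (hT : IsUnit T) (k : ℕ) :
    ∃ N, 0 < N ∧ ∃ D : Module.End ℤ_[p] M, T ^ N = 1 + (p : ℤ_[p]) ^ k • D := by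
  classical
  let b := Module.Free.chooseBasis ℤ_[p] M
  let e := LinearMap.toMatrixAlgEquiv b
  let φ := (PadicInt.toZModPow (p := p) k).mapMatrix
    (m := Module.Free.ChooseBasisIndex ℤ_[p] M)
  have : NeZero (p ^ k) := ⟨pow_ne_zero _ (Fact.out : p.Prime).ne_zero⟩
  obtain ⟨U, hU⟩ := (hT.map e).map φ
  obtain ⟨N, hN, hUN⟩ := (isOfFinOrder_of_finite U).exists_pow_eq_one
  have h1 : φ (e (T ^ N) - 1) = 0 := by
    rw [map_sub, map_pow, map_pow, map_one, ← hU, ← Units.val_pow_eq_pow_val, hUN, Units.val_one,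
      sub_self]
  have h2 : ∀ i j, ∃ d, (e (T ^ N) - 1) i j = (p : ℤ_[p]) ^ k * d := by
    intro i j
    have h3 : PadicInt.toZModPow k ((e (T ^ N) - 1) i j) = 0 := congrFun (congrFun h1 i) j
    rw [← RingHom.mem_ker, PadicInt.ker_toZModPow, Ideal.mem_span_singleton] at h3
    exact h3
  choose d hd using h2
  refine ⟨N, hN, e.symm (Matrix.of d), e.injective ?_⟩
  rw [map_add, map_smul, map_one, AlgEquiv.apply_symm_apply, ← sub_eq_iff_eq_add']
  ext i j
  rw [hd]
  rfl

/-- Along a suitable arithmetic progression, a matrix coefficient of an invertible `p`-adic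
operator either vanishes identically or has finitely many zeros. -/
lemma exists_period_of_isUnit {p : ℕ} [Fact p.Prime] {M : Type*} [AddCommGroup M]
    [Module ℤ_[p] M] [Module.Finite ℤ_[p] M] [Module.Free ℤ_[p] M] {T : Module.End ℤ_[p] M}
    (hT : IsUnit T) :
    ∃ N, 0 < N ∧ ∀ (v : M) (l : M →ₗ[ℤ_[p]] ℤ_[p]),
      {n : ℕ | l ((T ^ (N * n)) v) = 0}.Finite ∨ ∀ n : ℕ, l ((T ^ (N * n)) v) = 0 := by
  obtain ⟨N, hN, D, hD⟩ := exists_pow_eq_one_add_smul hT 2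
  refine ⟨N, hN, fun v l ↦ or_iff_not_imp_left.2 fun hinf n ↦ ?_⟩
  let e : ℕ → ℚ_[p] := fun j ↦ (p : ℚ_[p]) ^ (2 * j) / (j.factorial : ℚ_[p]) * (l ((D ^ j) v))
  have he : ∀ j, ‖e j‖ ≤ ‖(p : ℚ_[p])‖ ^ j := by
    intro j
    have h1 : (0 : ℝ) < ‖(j.factorial : ℚ_[p])‖ := by
      simpa using Nat.factorial_ne_zero j
    have h2 := norm_prime_pow_le_norm_factorial p j
    have h3 : ‖((l ((D ^ j) v) : ℤ_[p]) : ℚ_[p])‖ ≤ 1 := PadicInt.norm_le_one _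
    rw [norm_mul, norm_div, two_mul, pow_add, norm_mul, mul_div_assoc, ← norm_pow]
    calc _ ≤ ‖(p : ℚ_[p]) ^ j‖ * 1 * 1 := by
          gcongr
          exact (div_le_one h1).2 h2
      _ = _ := by ring
  have hf : ∀ n, ((l ((T ^ (N * n)) v) : ℤ_[p]) : ℚ_[p]) =
      ∑ j ∈ Finset.range (n + 1), e j * (n.descFactorial j : ℚ_[p]) := by
    intro n
    rw [pow_mul, hD, add_comm, (Commute.one_right _).add_pow, LinearMap.sum_apply, map_sum,
      PadicInt.coe_sum]
    refine Finset.sum_congr rfl fun j _ ↦ ?_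
    have h1 : (((p : ℤ_[p]) ^ 2 • D) ^ j * 1 ^ (n - j) * ((n.choose j : ℕ) : Module.End ℤ_[p] M)) v
        = ((p : ℤ_[p]) ^ (2 * j) * (n.choose j : ℤ_[p])) • (D ^ j) v := by
      rw [one_pow, mul_one, smul_pow, ← pow_mul, Module.End.mul_apply, Module.End.natCast_apply,
        LinearMap.smul_apply, map_nsmul, mul_smul, Nat.cast_smul_eq_nsmul]
    have h2 : (j.factorial : ℚ_[p]) ≠ 0 := by exact_mod_cast Nat.factorial_ne_zero j
    rw [h1, map_smul, smul_eq_mul, Nat.descFactorial_eq_factorial_mul_choose]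
    push_cast
    simp only [e]
    field_simp
  have h := eq_zero_of_infinite_zeros (norm_nonneg _) Padic.norm_p_lt_one he hf
    (by simpa only [PadicInt.coe_eq_zero, Set.Infinite] using hinf) n
  simpa only [PadicInt.coe_eq_zero] using h

/-- The companion operator of a linear recurrence, acting on windows of consecutive values. -/
def companionEnd (R : Type*) {S : Type*} [CommRing R] [CommRing S] [Algebra R S] {k : ℕ}
    (b : Fin (k + 1) → S) : Module.End R (Fin (k + 1) → S) where
  toFun x := Fin.snoc (fun i : Fin k ↦ x i.succ) (∑ i, b i * x i)
  map_add' x y := by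
    ext i
    induction i using Fin.lastCases <;> simp [mul_add, Finset.sum_add_distrib]
  map_smul' c x := by
    ext i
    induction i using Fin.lastCases <;> simp [Finset.smul_sum]

lemma isUnit_companionEnd {R S : Type*} [CommRing R] [CommRing S] [Algebra R S]
    [Module.Finite R S] {k : ℕ} {b : Fin (k + 1) → S} (hb : IsUnit (b 0)) :
    IsUnit (companionEnd R b) := by
  rw [Module.End.isUnit_iff]
  refine OrzechProperty.bijective_of_surjective_endomorphism _ fun y ↦ ?_
  obtain ⟨c, hc⟩ := hb.exists_right_inv
  refine ⟨Fin.cons (c * (y (Fin.last k) - ∑ i : Fin k, b i.succ * y i.castSucc))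
    fun i : Fin k ↦ y i.castSucc, ?_⟩
  ext i
  induction i using Fin.lastCases with
  | last => simp [companionEnd, Fin.sum_univ_succ, ← mul_assoc, hc]
  | cast i => simp [companionEnd]

lemma companionEnd_pow_apply {R S : Type*} [CommRing R] [CommRing S] [Algebra R S] {k : ℕ}
    {b : Fin (k + 1) → S} {w : ℕ → S} (hw : ∀ n, w (n + (k + 1)) = ∑ i, b i * w (n + (i : ℕ)))
    (m r : ℕ) :
    (companionEnd R b ^ m) (fun i : Fin (k + 1) ↦ w (r + (i : ℕ))) =
      fun i : Fin (k + 1) ↦ w (r + m + (i : ℕ)) := by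
  induction m with
  | zero => simp
  | succ m ih =>
    rw [pow_succ', Module.End.mul_apply, ih]
    ext i
    induction i using Fin.lastCases with
    | last =>
      simp only [companionEnd, LinearMap.coe_mk, AddHom.coe_mk, Fin.snoc_last, Fin.val_last,
        ← hw]
      congr 1; ring
    | cast i =>
      simp only [companionEnd, LinearMap.coe_mk, AddHom.coe_mk, Fin.snoc_castSucc, Fin.val_succ,
        Fin.val_castSucc]
      congr 1; ring

/-- The property of a set of naturals that, for a suitable modulus `N`, its trace on every residue
class modulo `N` is finite or, up to an initial segment, everything. -/
def IsEventuallyPeriodicUpToFinite (Z : Set ℕ) : Prop :=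
  ∃ N, 0 < N ∧ ∃ r₀, ∀ r ≥ r₀, {n | r + N * n ∈ Z}.Finite ∨ ∀ n, r + N * n ∈ Z

lemma isEventuallyPeriodicUpToFinite_padic {p : ℕ} [Fact p.Prime] {S : Type*} [CommRing S]
    [Algebra ℤ_[p] S] [Module.Finite ℤ_[p] S] [Module.Free ℤ_[p] S] {k : ℕ}
    {b : Fin (k + 1) → S} (hb : IsUnit (b 0)) {w : ℕ → S}
    (hw : ∀ n, w (n + (k + 1)) = ∑ i, b i * w (n + (i : ℕ))) :
    IsEventuallyPeriodicUpToFinite {n | w n = 0} := by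
  obtain ⟨N, hN, h⟩ := exists_period_of_isUnit (isUnit_companionEnd (R := ℤ_[p]) hb)
  refine ⟨N, hN, 0, fun r _ ↦ ?_⟩
  let B := Module.Free.chooseBasis ℤ_[p] S
  have hB : ∀ n, w (r + N * n) = 0 ↔ ∀ i, (B.coord i ∘ₗ LinearMap.proj 0)
      ((companionEnd ℤ_[p] b ^ (N * n)) fun i : Fin (k + 1) ↦ w (r + (i : ℕ))) = 0 := by
    intro n
    rw [companionEnd_pow_apply (R := ℤ_[p]) hw]
    simpa using B.forall_coord_eq_zero_iff.symm
  simp only [Set.mem_ofPred_eq, hB]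
  by_cases hfin : ∃ i, {n | (B.coord i ∘ₗ LinearMap.proj 0)
      ((companionEnd ℤ_[p] b ^ (N * n)) fun i : Fin (k + 1) ↦ w (r + (i : ℕ))) = 0}.Finite
  · obtain ⟨i, hi⟩ := hfin
    exact .inl (hi.subset fun n hn ↦ hn i)
  · push Not at hfin
    exact .inr fun n i ↦ (h _ _).resolve_left (hfin i) n

lemma IsEventuallyPeriodicUpToFinite.of_succ {Z : Set ℕ}
    (h : IsEventuallyPeriodicUpToFinite {n | n + 1 ∈ Z}) : IsEventuallyPeriodicUpToFinite Z := by
  obtain ⟨N, hN, r₀, h⟩ := h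
  refine ⟨N, hN, r₀ + 1, fun r hr ↦ ?_⟩
  obtain ⟨s, rfl⟩ : ∃ s, r = s + 1 := ⟨r - 1, by lia⟩
  simpa only [Set.mem_ofPred_eq, add_right_comm] using h s (by lia)

lemma IsEventuallyPeriodicUpToFinite.exists_eq_union {Z : Set ℕ}
    (h : IsEventuallyPeriodicUpToFinite Z) :
    ∃ (F : Finset ℕ) (m : ℕ) (P : Fin m → ℕ × ℕ), (∀ j, 1 ≤ (P j).2) ∧
      Z = (F : Set ℕ) ∪ ⋃ j : Fin m, { x : ℕ | ∃ n : ℕ, x = (P j).1 + (P j).2 * n } := by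
  classical
  obtain ⟨N, hN, r₀, h⟩ := h
  let A := (Finset.Ico r₀ (r₀ + N)).filter fun r ↦ ∀ n, r + N * n ∈ Z
  let F := {x ∈ Z | ∀ r ∈ A, ∀ n, x ≠ r + N * n}
  have hF : F.Finite := by
    have hsub : F ⊆ (Finset.range r₀ : Set ℕ) ∪ ⋃ r ∈ Finset.Ico r₀ (r₀ + N) \ A,
        (fun n ↦ r + N * n) '' {n | r + N * n ∈ Z} := by
      rintro x ⟨hxZ, hx⟩
      rcases lt_or_ge x r₀ with hlt | hge
      · exact .inl (by simpa using hlt)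
      · have hdiv : x = (r₀ + (x - r₀) % N) + N * ((x - r₀) / N) := by
          have := Nat.mod_add_div (x - r₀) N
          lia
        have hmod := Nat.mod_lt (x - r₀) hN
        refine .inr (Set.mem_biUnion (x := r₀ + (x - r₀) % N) ?_ ⟨(x - r₀) / N, ?_, hdiv.symm⟩)
        · simp only [Finset.coe_sdiff, Set.mem_sdiff, Finset.mem_coe, Finset.mem_Ico]
          exact ⟨by lia, fun hA ↦ hx _ hA _ hdiv⟩
        · rwa [Set.mem_ofPred_eq, ← hdiv]
    refine (Set.Finite.union (Finset.finite_toSet _) ?_).subset hsub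
    refine Set.Finite.biUnion (Finset.finite_toSet _) fun r hr ↦ Set.Finite.image _ ?_
    simp only [Finset.coe_sdiff, Set.mem_sdiff, Finset.mem_coe, Finset.mem_Ico, A,
      Finset.mem_filter, not_and] at hr
    exact (h r hr.1.1).resolve_right (hr.2 hr.1)
  refine ⟨hF.toFinset, A.card, fun j ↦ ((A.equivFin.symm j : ℕ), N), fun _ ↦ hN, ?_⟩
  ext x
  simp only [Set.Finite.coe_toFinset, Set.mem_union, Set.mem_iUnion, Set.mem_ofPred_eq]
  constructor
  · intro hx
    by_cases hxA : ∃ r ∈ A, ∃ n, x = r + N * n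
    · obtain ⟨r, hr, n, rfl⟩ := hxA
      exact .inr ⟨A.equivFin ⟨r, hr⟩, n, by simp⟩
    · push Not at hxA
      exact .inl ⟨hx, hxA⟩
  · rintro (hx | ⟨j, n, rfl⟩)
    · exact hx.1
    · exact (Finset.mem_filter.1 (A.equivFin.symm j).2).2 n


open Cardinal in
lemma exists_algebraicIndependent_padic (p : ℕ) [Fact p.Prime] {ι : Type} (hι : #ι ≤ 𝔠) :
    ∃ y : ι → ℚ_[p], AlgebraicIndependent ℤ y := by
  obtain ⟨s, hs⟩ := exists_isTranscendenceBasis ℤ ℚ_[p]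
  have hcard : 𝔠 ≤ #s := by
    have := hs.isAlgebraic
    have h1 := continuum_le_cardinal_of_nontriviallyNormedField ℚ_[p]
    have h2 := Algebra.IsAlgebraic.cardinalMk_le_max
      (Algebra.adjoin ℤ (Set.range ((↑) : s → ℚ_[p]))) ℚ_[p]
    have h3 := Algebra.cardinalMk_adjoin_le ℤ (Set.range ((↑) : s → ℚ_[p]))
    rw [Subtype.range_coe] at h2 h3
    by_contra! hlt
    have h4 : max (max #ℤ #s) ℵ₀ < 𝔠 := by
      simp [hlt, aleph0_lt_continuum]
    exact absurd (h1.trans h2) (not_le.2 (max_lt (h3.trans_lt h4) aleph0_lt_continuum))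
  obtain ⟨f⟩ := (Cardinal.le_def _ _).1 (hι.trans hcard)
  exact ⟨_, hs.1.comp f f.injective⟩

/-- Algebraically independent `p`-adic integers with prescribed residues. -/
lemma exists_algebraicIndependent_padicInt (p : ℕ) [Fact p.Prime] {ι : Type}
    (hι : Cardinal.mk ι ≤ Cardinal.continuum) (a : ι → ℤ) :
    ∃ t : ι → ℤ_[p], AlgebraicIndependent ℤ t ∧
      ∀ i, PadicInt.toZMod (t i) = (a i : ZMod p) := by
  obtain ⟨y, hy⟩ := exists_algebraicIndependent_padic p hι
  have hk : ∀ i, ∃ k : ℕ, ‖(p : ℚ_[p]) ^ k * y i‖ < 1 := by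
    intro i
    have h : Filter.Tendsto (fun k : ℕ ↦ ‖(p : ℚ_[p])‖ ^ k * ‖y i‖) Filter.atTop (nhds 0) := by
      simpa using (tendsto_pow_atTop_nhds_zero_of_lt_one (norm_nonneg _)
        (Padic.norm_p_lt_one (p := p))).mul_const ‖y i‖
    obtain ⟨k, hk⟩ := (h.eventually_lt_const zero_lt_one).exists
    exact ⟨k, by simpa using hk⟩
  choose k hk using hk
  let z : ι → ℤ_[p] := fun i ↦ ⟨(p : ℚ_[p]) ^ k i * y i, (hk i).le⟩
  let f : ι → Polynomial ℤ := fun i ↦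
    Polynomial.C ((p : ℤ) ^ k i) * Polynomial.X + Polynomial.C (a i)
  have hp0 : ∀ i, (p : ℤ) ^ k i ≠ 0 := fun i ↦
    pow_ne_zero _ (by exact_mod_cast (Fact.out : p.Prime).ne_zero)
  have hf : ∀ i, Transcendental ℤ (f i) := fun i ↦ by
    refine Polynomial.transcendental _ ?_ ?_
    · simp only [f]
      rw [Polynomial.natDegree_linear (hp0 i)]
      exact one_ne_zero
    · simp only [f]
      rw [Polynomial.leadingCoeff_linear (hp0 i)]
      exact mem_nonZeroDivisors_of_ne_zero (hp0 i)
  have h1 := hy.polynomial_aeval_of_transcendental hf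
  refine ⟨fun i ↦ z i + a i, ?_, fun i ↦ ?_⟩
  · refine AlgebraicIndependent.of_comp (PadicInt.Coe.ringHom (p := p)).toIntAlgHom ?_
    convert h1 using 2 with i
    simp only [f, z, map_add, map_mul, map_pow, Polynomial.aeval_X,
      eq_intCast, Int.cast_natCast, Function.comp_apply]
    exact (PadicInt.coe_add _ _).trans (by simp)
  · have : z i ∈ RingHom.ker (PadicInt.toZMod (p := p)) := by
      rw [PadicInt.ker_toZMod, IsLocalRing.mem_maximalIdeal, PadicInt.mem_nonunits]
      exact hk i
    rw [map_add, RingHom.mem_ker.1 this, zero_add, map_intCast]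

/-- If `E` is algebraic over a subring `A` of `ℤ_[p]`, then `E` embeds into the algebraic closure
of `ℚ_[p]` so that roots of polynomials over `A` with leading coefficient a `p`-adic unit become
`p`-adically integral. -/
lemma exists_ringHom_isIntegral_of_isUnit_leadingCoeff {p : ℕ} [Fact p.Prime] {A : Type*}
    (E : Type*) [CommRing A] [IsDomain A] [Field E] [Algebra A E] [FaithfulSMul A E]
    [Algebra.IsAlgebraic A E] {f : A →+* ℤ_[p]} (hf : Function.Injective f) :
    ∃ φ : E →+* AlgebraicClosure ℚ_[p], ∀ (P : Polynomial A) (g : E), Polynomial.aeval g P = 0 →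
      IsUnit (f P.leadingCoeff) → IsIntegral ℤ_[p] (φ g) := by
  let _ : Algebra A ℤ_[p] := f.toAlgebra
  have : FaithfulSMul A ℤ_[p] := (faithfulSMul_iff_algebraMap_injective _ _).2 hf
  let _ : Algebra A (AlgebraicClosure ℚ_[p]) :=
    ((algebraMap ℤ_[p] (AlgebraicClosure ℚ_[p])).comp (algebraMap A ℤ_[p])).toAlgebra
  have : IsScalarTower A ℤ_[p] (AlgebraicClosure ℚ_[p]) := .of_algebraMap_eq' rfl
  have : FaithfulSMul ℤ_[p] (AlgebraicClosure ℚ_[p]) := .trans ℤ_[p] ℚ_[p] _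
  have : FaithfulSMul A (AlgebraicClosure ℚ_[p]) := .trans A ℤ_[p] _
  let φ : E →ₐ[A] AlgebraicClosure ℚ_[p] := IsAlgClosed.lift
  refine ⟨φ, fun P g hP hunit ↦ ?_⟩
  obtain ⟨c, hc⟩ := hunit.exists_left_inv
  have h := (((isIntegral_leadingCoeff_smul P g hP).map φ).tower_top (A := ℤ_[p])).smul c
  rwa [map_smul, ← algebraMap_smul ℤ_[p] P.leadingCoeff, smul_smul, RingHom.algebraMap_toAlgebra,
    hc, one_smul] at h

lemma PadicInt.isUnit_aeval_of_toZMod_eq {p : ℕ} [Fact p.Prime] {ι : Type*} {t : ι → ℤ_[p]}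
    {a : ι → ℤ} (hta : ∀ i, PadicInt.toZMod (t i) = (a i : ZMod p)) {L : MvPolynomial ι ℤ}
    (hL : ¬ (p : ℤ) ∣ MvPolynomial.eval a L) : IsUnit (MvPolynomial.aeval t L) := by
  by_contra h
  have h2 : MvPolynomial.aeval t L ∈ RingHom.ker (PadicInt.toZMod (p := p)) := by
    rwa [PadicInt.ker_toZMod, IsLocalRing.mem_maximalIdeal]
  have h1 : PadicInt.toZMod (MvPolynomial.aeval t L) =
      Int.castRingHom _ (MvPolynomial.eval a L) := by
    rw [MvPolynomial.aeval_def, MvPolynomial.hom_eval₂, ← MvPolynomial.eval₂_id,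
      MvPolynomial.hom_eval₂]
    congr 1
    · exact RingHom.ext_int _ _
    · exact funext hta
  rw [RingHom.mem_ker.1 h2, eq_comm, eq_intCast, ZMod.intCast_zmod_eq_zero_iff_dvd] at h1
  exact hL h1

/-- A nonzero integer polynomial takes a `p`-adic unit value at some algebraically independent
family of `p`-adic integers, for a suitable prime `p`. -/
lemma exists_algebraicIndependent_isUnit_aeval {ι : Type}
    (hι : Cardinal.mk ι ≤ Cardinal.continuum) {L : MvPolynomial ι ℤ} (hL : L ≠ 0) :
    ∃ (p : ℕ) (_ : Fact p.Prime) (t : ι → ℤ_[p]),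
      AlgebraicIndependent ℤ t ∧ IsUnit (MvPolynomial.aeval t L) := by
  obtain ⟨a, ha⟩ : ∃ a : ι → ℤ, MvPolynomial.eval a L ≠ 0 := by
    by_contra! h
    exact hL (MvPolynomial.funext fun a ↦ by simpa using h a)
  obtain ⟨p, hlt, hp⟩ := Nat.exists_infinite_primes ((MvPolynomial.eval a L).natAbs + 1)
  have : Fact p.Prime := ⟨hp⟩
  obtain ⟨t, ht, hta⟩ := exists_algebraicIndependent_padicInt p hι a
  exact ⟨p, this, t, ht, PadicInt.isUnit_aeval_of_toZMod_eq hta fun h ↦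
    ha (Int.natAbs_eq_zero.1 (Nat.eq_zero_of_dvd_of_lt (Int.natCast_dvd.1 h) hlt))⟩

/-- Any finite set of real numbers can be sent to `p`-adically integral elements by a field
embedding, for a suitable prime `p`. -/
lemma exists_ringHom_isIntegral_padicInt {G : Set ℝ} (hG : G.Finite) :
    ∃ (p : ℕ) (_ : Fact p.Prime) (φ : ℝ →+* AlgebraicClosure ℚ_[p]),
      ∀ g ∈ G, IsIntegral ℤ_[p] (φ g) := by
  obtain ⟨s, hs⟩ := exists_isTranscendenceBasis ℤ ℝ
  have hcard : Cardinal.mk s ≤ Cardinal.continuum := Cardinal.mk_real ▸ Cardinal.mk_set_le s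
  let _ : Algebra (MvPolynomial s ℤ) ℝ := (MvPolynomial.aeval ((↑) : s → ℝ)).toAlgebra
  have hinj : Function.Injective (algebraMap (MvPolynomial s ℤ) ℝ) := hs.1
  have := (faithfulSMul_iff_algebraMap_injective _ _).2 hinj
  have halg : Algebra.IsAlgebraic (MvPolynomial s ℤ) ℝ := by
    have := hs.isAlgebraic
    exact .of_ringHom_of_comp_eq hs.1.aevalEquiv.toRingHom (RingHom.id ℝ)
      hs.1.aevalEquiv.surjective Function.injective_id
      (by ext <;> simp [RingHom.algebraMap_toAlgebra])
  choose P hP0 hP using fun g : ℝ ↦ halg.isAlgebraic g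
  have hL : ∏ g ∈ hG.toFinset, (P g).leadingCoeff ≠ 0 :=
    Finset.prod_ne_zero_iff.2 fun g _ ↦ Polynomial.leadingCoeff_ne_zero.2 (hP0 g)
  obtain ⟨p, hp, t, ht, hLt⟩ := exists_algebraicIndependent_isUnit_aeval hcard hL
  have hinjt : Function.Injective
      ((MvPolynomial.aeval t : MvPolynomial s ℤ →ₐ[ℤ] ℤ_[p]) : MvPolynomial s ℤ →+* ℤ_[p]) := ht
  obtain ⟨φ, hφ⟩ := exists_ringHom_isIntegral_of_isUnit_leadingCoeff ℝ hinjt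
  refine ⟨p, hp, φ, fun g hg ↦ hφ (P g) g (hP g) ?_⟩
  rw [map_prod, IsUnit.prod_iff] at hLt
  exact hLt g (hG.mem_toFinset.2 hg)

lemma isEventuallyPeriodicUpToFinite_of_ne_zero {k : ℕ} {b : Fin (k + 1) → ℝ} (hb : b 0 ≠ 0)
    {u : ℕ → ℝ} (hu : ∀ n, u (n + (k + 1)) = ∑ i, b i * u (n + (i : ℕ))) :
    IsEventuallyPeriodicUpToFinite {n | u n = 0} := by
  let G : Set ℝ := insert (b 0)⁻¹ (Set.range b ∪ u '' Set.Iio (k + 1))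
  have hG : G.Finite :=
    ((Set.finite_range b).union ((Set.finite_Iio (k + 1)).image u)).insert _
  obtain ⟨p, _, φ, hφ⟩ := exists_ringHom_isIntegral_padicInt hG
  let S := Algebra.adjoin ℤ_[p] (φ '' G)
  have hS : ∀ g ∈ G, φ g ∈ S := fun g hg ↦ Algebra.subset_adjoin ⟨g, hg, rfl⟩
  have : Module.Finite ℤ_[p] S := Module.Finite.iff_fg.2 <|
    fg_adjoin_of_finite (hG.image φ) (Set.forall_mem_image.2 hφ)
  have : FaithfulSMul ℤ_[p] (AlgebraicClosure ℚ_[p]) := .trans ℤ_[p] ℚ_[p] _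
  have hbS : ∀ i, φ (b i) ∈ S := fun i ↦ hS _ (.inr (.inl ⟨i, rfl⟩))
  have huS : ∀ n, φ (u n) ∈ S := by
    intro n
    induction n using Nat.strong_induction_on with
    | _ n ih =>
      rcases lt_or_ge n (k + 1) with hn | hn
      · exact hS _ (.inr (.inr ⟨n, hn, rfl⟩))
      · obtain ⟨m, rfl⟩ := Nat.exists_eq_add_of_le' hn
        rw [hu, map_sum]
        exact sum_mem fun i _ ↦ map_mul φ _ _ ▸ mul_mem (hbS i) (ih _ (by lia))
  have hunit : IsUnit (⟨φ (b 0), hbS 0⟩ : S) :=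
    .of_mul_eq_one ⟨φ (b 0)⁻¹, hS _ (.inl rfl)⟩ <| Subtype.ext <| by
      simp [mul_inv_cancel₀ ((map_ne_zero φ).2 hb)]
  have h := isEventuallyPeriodicUpToFinite_padic (p := p) (b := fun i ↦ (⟨φ (b i), hbS i⟩ : S)) hunit
    (w := fun n ↦ ⟨φ (u n), huS n⟩) fun n ↦ Subtype.ext <| by
      simp [hu]
  simpa only [Subtype.ext_iff, ZeroMemClass.coe_zero, map_eq_zero] using h

lemma isEventuallyPeriodicUpToFinite_of_recurrence {u : ℕ → ℝ} {k : ℕ} {b : Fin k → ℝ}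
    (hu : ∀ n, u (n + k) = ∑ i, b i * u (n + (i : ℕ))) :
    IsEventuallyPeriodicUpToFinite {n | u n = 0} := by
  induction k generalizing u with
  | zero => exact ⟨1, one_pos, 0, fun r _ ↦ .inr fun n ↦ by simpa using hu (r + 1 * n)⟩
  | succ k ih =>
    by_cases hb : b 0 = 0
    · refine .of_succ (ih (u := fun n ↦ u (n + 1)) (b := fun i ↦ b i.succ) fun n ↦ ?_)
      have := hu n
      simpa [Fin.sum_univ_succ, hb, add_assoc] using this
    · exact isEventuallyPeriodicUpToFinite_of_ne_zero hb hu

/-- **Skolem–Mahler–Lech.** The zero set of a real linear recurrence sequence is the union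
of a finite set and finitely many arithmetic progressions `{ p + k·n : n ∈ ℕ }` with
`k ≥ 1`. -/
theorem stmt16 (u : ℕ → ℝ) (k : ℕ) (b : Fin k → ℝ)
    (hrec : ∀ n : ℕ, u (n + k) = ∑ i : Fin k, b i * u (n + (i : ℕ))) :
    ∃ (F : Finset ℕ) (m : ℕ) (P : Fin m → ℕ × ℕ),
      (∀ j, 1 ≤ (P j).2) ∧
      { n : ℕ | u n = 0 }
        = (F : Set ℕ) ∪ ⋃ j : Fin m, { x : ℕ | ∃ n : ℕ, x = (P j).1 + (P j).2 * n } :=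
  (isEventuallyPeriodicUpToFinite_of_recurrence hrec).exists_eq_union
end
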